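/- It is decidable, given a finite game graph G, whether G yields recurring hierarchical information, i.e., whether every play of G has infinitely many prefix histories that yield hierarchical information. -/

import Mathlib

/-! Finitely-coded games: a concrete, `Primcodable` representation of finite game
graphs, used to state decidability results.  A coded game consists of: the number
of positions (positions are `0, …, numPos`, with initial position `0`), a finite
list of moves `(source, action profile, target)`, and an observation table whose
`i`-th row gives the observations of player `i` at each position (its length is
the number of players). -/

namespace CG

/-- A coded finite game graph: `(numPos, moves, obsTable)`. -/
abbrev Game : Type := ℕ × List (ℕ × List ℕ × ℕ) × List (List ℕ)

def numPos (c : Game) : ℕ := c.1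

def moves (c : Game) : List (ℕ × List ℕ × ℕ) := c.2.1

def obsTable (c : Game) : List (List ℕ) := c.2.2

/-- The number of players. -/
def numPlayers (c : Game) : ℕ := (obsTable c).length

/-- The observation of player `i` at position `v`. -/
def obsOf (c : Game) (i v : ℕ) : ℕ := ((obsTable c).getD i []).getD v 0

/-- The move relation, labelled by action profiles (coded as lists). -/
def Move (c : Game) (u : ℕ) (a : List ℕ) (w : ℕ) : Prop := (u, a, w) ∈ moves c

/-- Two positions are linked by a move for some action profile. -/
def Step (c : Game) (u w : ℕ) : Prop := ∃ a, Move c u a w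

/-- A history: a nonempty sequence of valid positions starting at the initial
position `0`, each consecutive pair lying on a move. -/
def IsHistory (c : Game) (π : List ℕ) : Prop :=
  π.head? = some 0 ∧ (∀ v ∈ π, v ≤ numPos c) ∧ π.Chain' (Step c)

/-- The observation sequence of player `i` along a history (the observation at
the initial position is discarded). -/
def obsSeq (c : Game) (i : ℕ) (π : List ℕ) : List ℕ := (π.drop 1).map (obsOf c i)

/-- Indistinguishability for player `i`. -/
def Indist (c : Game) (i : ℕ) (π π' : List ℕ) : Prop := obsSeq c i π = obsSeq c i π'

/-- The information set of player `i` at history `π`. -/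
def InfoSet (c : Game) (i : ℕ) (π : List ℕ) : Set (List ℕ) :=
  { π' | IsHistory c π' ∧ Indist c i π π' }

/-- The history `π` yields hierarchical information: the information sets of the
players are totally ordered by inclusion. -/
def HistHI (c : Game) (π : List ℕ) : Prop :=
  ∀ i < numPlayers c, ∀ j < numPlayers c,
    InfoSet c i π ⊆ InfoSet c j π ∨ InfoSet c j π ⊆ InfoSet c i π

/-- Static hierarchical information: there is a total order on the players such
that smaller players always have smaller information sets. -/
def StaticHI (c : Game) : Prop :=
  ∃ ord : ℕ → ℕ → Prop,
    (∀ i < numPlayers c, ord i i) ∧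
    (∀ i < numPlayers c, ∀ j < numPlayers c, ord i j ∨ ord j i) ∧
    (∀ i < numPlayers c, ∀ j < numPlayers c, ∀ k < numPlayers c,
      ord i j → ord j k → ord i k) ∧
    (∀ i < numPlayers c, ∀ j < numPlayers c, ord i j → ord j i → i = j) ∧
    (∀ i < numPlayers c, ∀ j < numPlayers c, ord i j →
      ∀ π, IsHistory c π → InfoSet c i π ⊆ InfoSet c j π)

/-- Dynamic hierarchical information: every history yields hierarchical information. -/
def DynamicHI (c : Game) : Prop := ∀ π, IsHistory c π → HistHI c π

/-- The prefix `v₀ … v_t` of a play, as a list. -/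
def playPrefix (f : ℕ → ℕ) (t : ℕ) : List ℕ := (List.range (t + 1)).map f

/-- A play: an infinite sequence all of whose prefixes are histories. -/
def IsPlay (c : Game) (f : ℕ → ℕ) : Prop := ∀ t, IsHistory c (playPrefix f t)

/-- Recurring hierarchical information: along every play, infinitely many prefix
histories yield hierarchical information. -/
def RecurringHI (c : Game) : Prop :=
  ∀ f, IsPlay c f → ∀ T, ∃ t, T ≤ t ∧ HistHI c (playPrefix f t)

/-- Information-consistency of a strategy of player `i`. -/
def Consistent (c : Game) (i : ℕ) (s : List ℕ → ℕ) : Prop :=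
  ∀ π π', IsHistory c π → IsHistory c π' → Indist c i π π' → s π = s π'

/-- A play follows a strategy profile `s`: at each round some move is taken whose
action profile agrees with the actions prescribed by `s` for every player. -/
def Follows (c : Game) (s : ℕ → List ℕ → ℕ) (f : ℕ → ℕ) : Prop :=
  IsPlay c f ∧ ∀ t, ∃ a, Move c (f t) a (f (t + 1)) ∧
    ∀ i < numPlayers c, a.getD i 0 = s i (playPrefix f t)

/-- A history follows a strategy profile `s`. -/
def HFollows (c : Game) (s : ℕ → List ℕ → ℕ) (π : List ℕ) : Prop :=
  IsHistory c π ∧ ∀ k, k + 1 < π.length →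
    ∃ a, Move c (π.getD k 0) a (π.getD (k + 1) 0) ∧
      ∀ i < numPlayers c, a.getD i 0 = s i (π.take (k + 1))

/-- A coded deterministic parity automaton over alphabet `ℕ`:
`(transition table ((state, letter), target), priorities)`; initial state `0`;
missing transitions default to state `0`. -/
abbrev DPA : Type := List ((ℕ × ℕ) × ℕ) × List ℕ

/-- The transition function of a coded parity automaton. -/
def dpaStep (d : DPA) (q v : ℕ) : ℕ :=
  ((d.1.find? fun e => e.1.1 == q && e.1.2 == v).map Prod.snd).getD 0

/-- The run of a coded parity automaton on an infinite word. -/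
def dpaRun (d : DPA) (f : ℕ → ℕ) : ℕ → ℕ
  | 0 => 0
  | t + 1 => dpaStep d (dpaRun d f t) (f t)

/-- The priority of a state. -/
def prio (d : DPA) (q : ℕ) : ℕ := d.2.getD q 0

/-- Parity acceptance: the least priority occurring infinitely often in the run is even. -/
def Accepts (d : DPA) (f : ℕ → ℕ) : Prop :=
  Even (sInf { p | ∃ᶠ t in Filter.atTop, prio d (dpaRun d f t) = p })

/-- A distributed winning strategy for the ω-regular winning condition given by
the parity automaton `d` over the positions. -/
def WinningProfile (c : Game) (d : DPA) (s : ℕ → List ℕ → ℕ) : Prop :=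
  (∀ i < numPlayers c, Consistent c i (s i)) ∧ ∀ f, Follows c s f → Accepts d f

/-- The game admits a distributed winning strategy. -/
def HasDWS (c : Game) (d : DPA) : Prop := ∃ s, WinningProfile c d s

/-- A Moore machine with finite state set `Q`, input alphabet `σ`, output alphabet `γ`. -/
structure Moore (σ γ : Type) where
  Q : Type
  finQ : Fintype Q
  q0 : Q
  δ : Q → σ → Q
  out : Q → γ

/-- The output letter of a Moore machine after reading a word. -/
def Moore.output {σ γ : Type} (mc : Moore σ γ) (w : List σ) : γ :=
  mc.out (w.foldl mc.δ mc.q0)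

/-- A finite-state strategy for player `i`: implemented by a Moore machine reading
the observation sequence of the history. -/
def FinStateStrategy (c : Game) (i : ℕ) (s : List ℕ → ℕ) : Prop :=
  ∃ mc : Moore ℕ ℕ, ∀ π, IsHistory c π → s π = mc.output (obsSeq c i π)

/-- The game admits a finite-state distributed winning strategy. -/
def HasFinDWS (c : Game) (d : DPA) : Prop :=
  ∃ s, WinningProfile c d s ∧ ∀ i < numPlayers c, FinStateStrategy c i (s i)

/-- The colour of position `v` under a coded colouring. -/
def colOf (γ : List ℕ) (v : ℕ) : ℕ := γ.getD v 0

/-- The colouring `γ` is observable: each player's observation distinguishes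
positions of different colours. -/
def Observable (c : Game) (γ : List ℕ) : Prop :=
  ∀ i < numPlayers c, ∀ v ≤ numPos c, ∀ w ≤ numPos c,
    colOf γ v ≠ colOf γ w → obsOf c i v ≠ obsOf c i w

/-- A distributed winning strategy for the winning condition over colours given
by the colouring `γ` and the parity automaton `d` over colours. -/
def WinningProfileCol (c : Game) (γ : List ℕ) (d : DPA) (s : ℕ → List ℕ → ℕ) : Prop :=
  (∀ i < numPlayers c, Consistent c i (s i)) ∧
    ∀ f, Follows c s f → Accepts d fun t => colOf γ (f t)

/-- The game admits a distributed winning strategy (colour version). -/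
def HasDWSCol (c : Game) (γ : List ℕ) (d : DPA) : Prop := ∃ s, WinningProfileCol c γ d s

/-- The game admits a finite-state distributed winning strategy (colour version). -/
def HasFinDWSCol (c : Game) (γ : List ℕ) (d : DPA) : Prop :=
  ∃ s, WinningProfileCol c γ d s ∧ ∀ i < numPlayers c, FinStateStrategy c i (s i)

/-- The strategy profile `s` maintains hierarchical information: every history
that follows `s` yields hierarchical information. -/
def Maintains (c : Game) (s : ℕ → List ℕ → ℕ) : Prop :=
  ∀ π, HFollows c s π → HistHI c π

end CG

/-- If an infinite path in a finite graph eventually stays inside `B`, then some such path does so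
from an index bounded by the number of vertices on. -/
theorem exists_path_eventually_mem_le {S : Type*} [Finite S] {R : S → S → Prop} {B : S → Prop}
    {s₀ : S} {x : ℕ → S} {T : ℕ} (h0 : x 0 = s₀) (hR : ∀ t, R (x t) (x (t + 1)))
    (hB : ∀ t, T ≤ t → B (x t)) :
    ∃ (y : ℕ → S) (T' : ℕ), T' ≤ Nat.card S ∧ y 0 = s₀ ∧ (∀ t, R (y t) (y (t + 1))) ∧
      ∀ t, T' ≤ t → B (y t) := by
  induction T using Nat.strong_induction_on generalizing x with
  | _ T ih =>
    rcases le_or_gt T (Nat.card S) with h | h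
    · exact ⟨x, T, h, h0, hR, hB⟩
    have hninj : ¬ Function.Injective (fun t : Fin T => x t) := fun hinj => by
      have := Nat.card_le_card_of_injective _ hinj
      simp at this
      omega
    obtain ⟨a, b, hab, hlt⟩ : ∃ a b : Fin T, x a = x b ∧ a < b := by
      simp only [Function.Injective, not_forall] at hninj
      obtain ⟨a, b, hab, hne⟩ := hninj
      rcases lt_or_gt_of_ne hne with h | h
      exacts [⟨a, b, hab, h⟩, ⟨b, a, hab.symm, h⟩]
    have hlt' : (a : ℕ) < b := hlt
    have hbT := b.2
    refine ih (T - (b - a)) (by omega) (x := fun t => if t ≤ a then x t else x (t + (b - a)))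
      (by simpa using h0) (fun t => ?_) (fun t ht => ?_)
    · rcases lt_trichotomy t a with h | h | h
      · rw [if_pos (by omega), if_pos (by omega)]
        exact hR t
      · rw [if_pos (by omega), if_neg (by omega), h, hab,
          show (a : ℕ) + 1 + (b - a) = b + 1 by omega]
        exact hR b
      · rw [if_neg (by omega), if_neg (by omega),
          show t + 1 + ((b : ℕ) - a) = t + (b - a) + 1 by omega]
        exact hR _
    · rw [if_neg (by omega)]
      exact hB _ (by omega)

/-- A finite path in a finite graph whose last part, longer than the number of vertices, lies
inside `B` can be turned into an infinite path eventually staying inside `B`. -/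
theorem exists_path_eventually_mem_of_finite {S : Type*} [Finite S] {R : S → S → Prop}
    {B : S → Prop} {x : ℕ → S} {T K : ℕ} (hK : Nat.card S ≤ K)
    (hR : ∀ t < T + K, R (x t) (x (t + 1))) (hB : ∀ t ≤ K, B (x (T + t))) :
    ∃ y : ℕ → S, y 0 = x 0 ∧ (∀ t, R (y t) (y (t + 1))) ∧ ∀ t, T ≤ t → B (y t) := by
  have hninj : ¬ Function.Injective (fun t : Fin (K + 1) => x (T + t)) := fun hinj => by
    have := Nat.card_le_card_of_injective _ hinj
    simp at this
    omega
  obtain ⟨a, b, hab, hlt⟩ : ∃ a b : Fin (K + 1), x (T + a) = x (T + b) ∧ a < b := by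
    simp only [Function.Injective, not_forall] at hninj
    obtain ⟨a, b, hab, hne⟩ := hninj
    rcases lt_or_gt_of_ne hne with h | h
    exacts [⟨a, b, hab, h⟩, ⟨b, a, hab.symm, h⟩]
  have hlt' : (a : ℕ) < b := hlt
  have hbK := b.2
  let idx : ℕ → ℕ := Nat.rec 0 fun _ k => if k + 1 = T + b then T + a else k + 1
  have idx_succ : ∀ t, idx (t + 1) = if idx t + 1 = T + b then T + a else idx t + 1 :=
    fun _ => rfl
  have hidx : ∀ t, min t (T + a) ≤ idx t ∧ idx t < T + b := by
    intro t
    induction t with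
    | zero => exact ⟨by simp, show 0 < T + (b : ℕ) by omega⟩
    | succ t ih =>
      rw [idx_succ]
      split_ifs <;> omega
  refine ⟨fun t => x (idx t), rfl, fun t => ?_, fun t ht => ?_⟩
  · have h := hidx t
    have hstep := hR (idx t) (by omega)
    simp only [idx_succ]
    split_ifs with he
    · rwa [he, ← hab] at hstep
    · exact hstep
  · have h := hidx t
    obtain ⟨k, hk⟩ := Nat.exists_eq_add_of_le (show T ≤ idx t by omega)
    simp only [hk]
    exact hB k (by omega)

namespace CG

theorem isHistory_iff_isChain (c : Game) (π : List ℕ) :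
    IsHistory c π ↔ π.head? = some 0 ∧ (∀ v ∈ π, v ≤ numPos c) ∧ π.IsChain (Step c) :=
  Iff.rfl

theorem isHistory_append_singleton {c : Game} {π : List ℕ} (hπ : π ≠ []) (v : ℕ) :
    IsHistory c (π ++ [v]) ↔
      IsHistory c π ∧ v ≤ numPos c ∧ ∀ u, π.getLast? = some u → Step c u v := by
  rw [isHistory_iff_isChain, isHistory_iff_isChain, List.head?_append_of_ne_nil _ hπ, List.isChain_append]
  simp [or_imp, forall_and]
  tauto

theorem IsHistory.ne_nil {c : Game} {π : List ℕ} (h : IsHistory c π) : π ≠ [] := by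
  rintro rfl
  simp [IsHistory] at h

theorem IsHistory.getLast?_eq {c : Game} {π : List ℕ} (h : IsHistory c π) :
    ∃ u ≤ numPos c, π.getLast? = some u :=
  ⟨π.getLast h.ne_nil, h.2.1 _ (List.getLast_mem _), List.getLast?_eq_some_getLast _⟩

theorem isHistory_singleton_zero (c : Game) : IsHistory c [0] := by
  simp [isHistory_iff_isChain]

theorem obsSeq_append_singleton (c : Game) (i : ℕ) {π : List ℕ} (hπ : π ≠ []) (v : ℕ) :
    obsSeq c i (π ++ [v]) = obsSeq c i π ++ [obsOf c i v] := by
  obtain ⟨a, π, rfl⟩ := List.exists_cons_of_ne_nil hπ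
  simp [obsSeq]

theorem indist_append_singleton (c : Game) (i : ℕ) {π ρ : List ℕ} (hπ : π ≠ []) (hρ : ρ ≠ [])
    (v w : ℕ) : Indist c i (π ++ [v]) (ρ ++ [w]) ↔
      Indist c i π ρ ∧ obsOf c i v = obsOf c i w := by
  simp [Indist, obsSeq_append_singleton, hπ, hρ]

theorem Indist.length_eq {c : Game} {i : ℕ} {π ρ : List ℕ} (hπ : π ≠ []) (hρ : ρ ≠ [])
    (h : Indist c i π ρ) : ρ.length = π.length := by
  have := congrArg List.length h
  have := List.length_pos_of_ne_nil hπ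
  have := List.length_pos_of_ne_nil hρ
  simp [obsSeq] at *
  omega

/-- Some history ending at `w` is indistinguishable from `π` for player `i`, and `b` tells whether
it is so for player `j` as well. -/
def Twin (c : Game) (π : List ℕ) (i j w : ℕ) (b : Bool) : Prop :=
  ∃ ρ, IsHistory c ρ ∧ ρ.getLast? = some w ∧ Indist c i π ρ ∧ (b = true ↔ Indist c j π ρ)

theorem twin_append_singleton {c : Game} {π : List ℕ} (hπ : π ≠ []) (v i j w : ℕ) (b : Bool) :
    Twin c (π ++ [v]) i j w b ↔ ∃ u a, Twin c π i j u a ∧ Step c u w ∧ w ≤ numPos c ∧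
      obsOf c i v = obsOf c i w ∧ (b = true ↔ a = true ∧ obsOf c j v = obsOf c j w) := by
  classical
  constructor
  · rintro ⟨ρ', hρ', hlast, hi, hj⟩
    have hlen := hi.length_eq (by simp) hρ'.ne_nil
    obtain ⟨ρ, rfl⟩ := List.getLast?_eq_some_iff.1 hlast
    have hρ : ρ ≠ [] := by
      rintro rfl
      simp at hlen
      exact hπ hlen
    rw [indist_append_singleton c _ hπ hρ] at hi hj
    rw [isHistory_append_singleton hρ] at hρ'
    obtain ⟨u, -, hu⟩ := hρ'.1.getLast?_eq
    exact ⟨u, decide (Indist c j π ρ), ⟨ρ, hρ'.1, hu, hi.1, by simp⟩, hρ'.2.2 u hu, hρ'.2.1, hi.2,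
      by simpa using hj⟩
  · rintro ⟨u, a, ⟨ρ, hρ, hlast, hi, hj⟩, hstep, hw, hvi, hb⟩
    refine ⟨ρ ++ [w], (isHistory_append_singleton hρ.ne_nil w).2 ⟨hρ, hw, ?_⟩, by simp,
      (indist_append_singleton c i hπ hρ.ne_nil v w).2 ⟨hi, hvi⟩, ?_⟩
    · rw [hlast]
      rintro u ⟨⟩
      exact hstep
    · rw [indist_append_singleton c j hπ hρ.ne_nil, hb, hj]

theorem Twin.le_numPos {c : Game} {π : List ℕ} {i j w : ℕ} {b : Bool} (h : Twin c π i j w b) :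
    w ≤ numPos c := by
  obtain ⟨ρ, hρ, hlast, -⟩ := h
  exact hρ.2.1 _ (List.mem_of_getLast? hlast)

theorem infoSet_subset_iff (c : Game) (π : List ℕ) (i j : ℕ) :
    InfoSet c i π ⊆ InfoSet c j π ↔ ∀ w, ¬ Twin c π i j w false := by
  constructor
  · rintro h w ⟨ρ, hρ, -, hi, hj⟩
    simp [(h ⟨hρ, hi⟩).2] at hj
  · rintro h ρ ⟨hρ, hi⟩
    obtain ⟨u, -, hu⟩ := hρ.getLast?_eq
    refine ⟨hρ, by_contra fun hj => h u ⟨ρ, hρ, hu, hi, by simpa using hj⟩⟩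

/-- The states of the finite graph tracking the information the players have along a history. -/
abbrev InfoState (c : Game) : Type :=
  Fin (numPos c + 1) ×
    Set (Fin (numPlayers c) × Fin (numPlayers c) × Fin (numPos c + 1) × Bool)

/-- The state reached after a history. -/
def infoState (c : Game) (π : List ℕ) : InfoState c :=
  (Fin.ofNat (numPos c + 1) (π.getLast?.getD 0), {q | Twin c π q.1 q.2.1 q.2.2.1 q.2.2.2})

/-- The number of states. -/
def numStates (c : Game) : ℕ :=
  (numPos c + 1) * 2 ^ (numPlayers c * (numPlayers c * ((numPos c + 1) * 2)))

theorem card_infoState (c : Game) : Nat.card (InfoState c) = numStates c := by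
  simp [numStates, Nat.card_eq_fintype_card]

theorem infoState_fst {c : Game} {π : List ℕ} {v : ℕ} (hv : v ≤ numPos c)
    (h : π.getLast? = some v) : ((infoState c π).1 : ℕ) = v := by
  simp [infoState, h, Nat.mod_eq_of_lt (Nat.lt_succ_of_le hv)]

theorem getLast?_eq_of_infoState_eq {c : Game} {π ρ : List ℕ} (hπ : IsHistory c π)
    (hρ : IsHistory c ρ) (h : infoState c π = infoState c ρ) : π.getLast? = ρ.getLast? := by
  obtain ⟨u, hu, hu'⟩ := hπ.getLast?_eq
  obtain ⟨w, hw, hw'⟩ := hρ.getLast?_eq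
  rw [hu', hw', ← infoState_fst hu hu', ← infoState_fst hw hw', h]

theorem twin_iff_of_infoState_eq {c : Game} {π ρ : List ℕ} (h : infoState c π = infoState c ρ)
    {i j : ℕ} (hi : i < numPlayers c) (hj : j < numPlayers c) (w : ℕ) (b : Bool) :
    Twin c π i j w b ↔ Twin c ρ i j w b := by
  by_cases hw : w ≤ numPos c
  · have := congrArg (fun s : InfoState c =>
      ((⟨i, hi⟩, ⟨j, hj⟩, ⟨w, Nat.lt_succ_of_le hw⟩, b) ∈ s.2)) h
    exact this.to_iff
  · exact ⟨fun h => absurd h.le_numPos hw, fun h => absurd h.le_numPos hw⟩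

theorem isHistory_append_of_infoState_eq {c : Game} {π ρ : List ℕ} (hπ : IsHistory c π)
    (hρ : IsHistory c ρ) (h : infoState c π = infoState c ρ) {v : ℕ}
    (hv : IsHistory c (π ++ [v])) : IsHistory c (ρ ++ [v]) := by
  rw [isHistory_append_singleton hπ.ne_nil, getLast?_eq_of_infoState_eq hπ hρ h] at hv
  exact (isHistory_append_singleton hρ.ne_nil v).2 ⟨hρ, hv.2⟩

theorem infoState_append_eq {c : Game} {π ρ : List ℕ} (hπ : π ≠ []) (hρ : ρ ≠ [])
    (h : infoState c π = infoState c ρ) (v : ℕ) :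
    infoState c (π ++ [v]) = infoState c (ρ ++ [v]) := by
  refine Prod.ext (by simp [infoState]) (Set.ext fun q => ?_)
  simp only [infoState, Set.mem_ofPred_eq, twin_append_singleton hπ, twin_append_singleton hρ,
    twin_iff_of_infoState_eq h q.1.2 q.2.1.2]

/-- The states reached after histories that do not yield hierarchical information. -/
def IncomparableState (c : Game) (s : InfoState c) : Prop :=
  ∃ i j, (∃ w, (i, j, w, false) ∈ s.2) ∧ ∃ w, (j, i, w, false) ∈ s.2

theorem not_histHI_iff (c : Game) (π : List ℕ) :
    ¬ HistHI c π ↔ IncomparableState c (infoState c π) := by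
  simp only [HistHI, infoSet_subset_iff, IncomparableState, infoState, Set.mem_ofPred_eq]
  push Not
  constructor
  · rintro ⟨i, hi, j, hj, ⟨w, hw⟩, w', hw'⟩
    exact ⟨⟨i, hi⟩, ⟨j, hj⟩, ⟨⟨w, Nat.lt_succ_of_le hw.le_numPos⟩, hw⟩,
      ⟨⟨w', Nat.lt_succ_of_le hw'.le_numPos⟩, hw'⟩⟩
  · rintro ⟨i, j, ⟨w, hw⟩, w', hw'⟩
    exact ⟨i, i.2, j, j.2, ⟨w, hw⟩, w', hw'⟩

/-- The edges of the graph of states. -/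
def StateStep (c : Game) (s s' : InfoState c) : Prop :=
  ∃ π v, IsHistory c π ∧ IsHistory c (π ++ [v]) ∧ infoState c π = s ∧ infoState c (π ++ [v]) = s'

theorem playPrefix_succ (f : ℕ → ℕ) (t : ℕ) :
    playPrefix f (t + 1) = playPrefix f t ++ [f (t + 1)] := by
  simp [playPrefix, List.range_succ]

theorem stateStep_playPrefix {c : Game} {f : ℕ → ℕ} {t : ℕ} (h : IsHistory c (playPrefix f t))
    (h' : IsHistory c (playPrefix f (t + 1))) :
    StateStep c (infoState c (playPrefix f t)) (infoState c (playPrefix f (t + 1))) :=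
  ⟨playPrefix f t, f (t + 1), h, playPrefix_succ f t ▸ h', rfl, by rw [playPrefix_succ]⟩

theorem playPrefix_zero_of_isHistory {c : Game} {f : ℕ → ℕ} (h : IsHistory c (playPrefix f 0)) :
    playPrefix f 0 = [0] := by
  simpa [playPrefix] using h.1

theorem exists_play_of_path {c : Game} {x : ℕ → InfoState c} (h0 : x 0 = infoState c [0])
    (hR : ∀ t, StateStep c (x t) (x (t + 1))) :
    ∃ f, IsPlay c f ∧ ∀ t, infoState c (playPrefix f t) = x t := by
  refine ⟨fun t => (x t).1, ?_⟩
  rw [IsPlay, ← forall_and]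
  intro t
  induction t with
  | zero =>
    have : playPrefix (fun t => ((x t).1 : ℕ)) 0 = [0] := by
      simp [playPrefix, h0, infoState]
    rw [this]
    exact ⟨isHistory_singleton_zero c, h0.symm⟩
  | succ t ih =>
    obtain ⟨π, v, hπ, hv, hs, hs'⟩ := hR t
    have hlast : ((x (t + 1)).1 : ℕ) = v := by
      rw [← hs']
      exact infoState_fst ((isHistory_append_singleton hπ.ne_nil v).1 hv).2.1 (by simp)
    have heq : infoState c π = infoState c (playPrefix (fun t => ((x t).1 : ℕ)) t) :=
      hs.trans ih.2.symm
    rw [playPrefix_succ, hlast, ← hs']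
    exact ⟨isHistory_append_of_infoState_eq hπ ih.1 heq hv,
      (infoState_append_eq hπ.ne_nil ih.1.ne_nil heq v).symm⟩

theorem not_recurringHI_iff_exists_path (c : Game) :
    ¬ RecurringHI c ↔ ∃ (x : ℕ → InfoState c) (T : ℕ), x 0 = infoState c [0] ∧
      (∀ t, StateStep c (x t) (x (t + 1))) ∧ ∀ t, T ≤ t → IncomparableState c (x t) := by
  unfold RecurringHI
  push Not
  constructor
  · rintro ⟨f, hf, T, hT⟩
    exact ⟨fun t => infoState c (playPrefix f t), T,
      by simp only [playPrefix_zero_of_isHistory (hf 0)],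
      fun t => stateStep_playPrefix (hf t) (hf (t + 1)),
      fun t ht => (not_histHI_iff c _).1 (hT t ht)⟩
  · rintro ⟨x, T, h0, hR, hB⟩
    obtain ⟨f, hf, hx⟩ := exists_play_of_path h0 hR
    exact ⟨f, hf, T, fun t ht => (not_histHI_iff c _).2 (hx t ▸ hB t ht)⟩

/-- The words of a given length over `0, …, n`. -/
def words (n : ℕ) : ℕ → List (List ℕ)
  | 0 => [[]]
  | k + 1 => (words n k).flatMap fun l => (List.range (n + 1)).map fun v => v :: l

theorem mem_words {n k : ℕ} {l : List ℕ} :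
    l ∈ words n k ↔ l.length = k ∧ ∀ v ∈ l, v ≤ n := by
  induction k generalizing l with
  | zero => cases l <;> simp [words]
  | succ k ih =>
    cases l with
    | nil => simp [words]
    | cons a l =>
      simp [words, ih]
      tauto

theorem IsHistory.mem_words {c : Game} {π : List ℕ} (h : IsHistory c π) :
    π ∈ words (numPos c) π.length :=
  CG.mem_words.2 ⟨rfl, h.2.1⟩

theorem IsHistory.take {c : Game} {π : List ℕ} (h : IsHistory c π) (t : ℕ) :
    IsHistory c (π.take (t + 1)) := by
  refine ⟨?_, fun v hv => h.2.1 v (List.mem_of_mem_take hv), h.2.2.take _⟩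
  rw [List.head?_take, if_neg (by omega)]
  exact h.1

theorem playPrefix_getD {π : List ℕ} {t : ℕ} (h : t < π.length) :
    playPrefix (fun k => π.getD k 0) t = π.take (t + 1) := by
  apply List.ext_getElem
  · simp only [playPrefix, List.length_map, List.length_range, List.length_take]
    omega
  · intro k hk hk'
    simp only [playPrefix, List.length_map, List.length_range, List.getElem_map,
      List.getElem_range, List.getElem_take] at hk ⊢
    grind

theorem take_playPrefix (f : ℕ → ℕ) {t k : ℕ} (h : k ≤ t) :
    (playPrefix f t).take (k + 1) = playPrefix f k := by
  simp [playPrefix, ← List.map_take, List.take_range, h]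

theorem not_recurringHI_iff (c : Game) :
    ¬ RecurringHI c ↔ ∃ T ∈ List.range (numStates c + 1),
      ∃ π ∈ words (numPos c) (T + numStates c + 1), IsHistory c π ∧
        ∀ t ∈ List.range (numStates c + 1), ¬ HistHI c (π.take (T + t + 1)) := by
  rw [not_recurringHI_iff_exists_path]
  simp only [List.mem_range, Nat.lt_succ_iff]
  constructor
  · rintro ⟨x, T, h0, hR, hB⟩
    obtain ⟨y, T, hT, h0, hR, hB⟩ := exists_path_eventually_mem_le h0 hR hB
    obtain ⟨f, hf, hy⟩ := exists_play_of_path h0 hR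
    rw [card_infoState] at hT
    refine ⟨T, hT, playPrefix f (T + numStates c), ?_, hf _, fun t ht => ?_⟩
    · simpa [playPrefix] using (hf (T + numStates c)).mem_words
    · rw [take_playPrefix f (by omega), not_histHI_iff, hy]
      exact hB _ (by omega)
  · rintro ⟨T, -, π, hmem, hπ, hB⟩
    have hlen := (mem_words.1 hmem).1
    have hpre : ∀ t ≤ T + numStates c, playPrefix (fun k => π.getD k 0) t = π.take (t + 1) :=
      fun t ht => playPrefix_getD (by omega)
    have hhist : ∀ t ≤ T + numStates c, IsHistory c (playPrefix (fun k => π.getD k 0) t) :=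
      fun t ht => hpre t ht ▸ hπ.take t
    obtain ⟨y, h0, hR, hB⟩ := exists_path_eventually_mem_of_finite
      (x := fun t => infoState c (playPrefix (fun k => π.getD k 0) t)) (card_infoState c).le
      (R := StateStep c) (B := IncomparableState c) (T := T)
      (fun t ht => stateStep_playPrefix (hhist t ht.le) (hhist (t + 1) ht))
      (fun t ht => (not_histHI_iff c _).1 (by rw [hpre _ (by omega)]; exact hB t ht))
    exact ⟨y, T, by rw [h0]; simp only [playPrefix_zero_of_isHistory (hhist 0 (by omega))], hR, hB⟩

section Primrec

variable {α β : Type*} [Primcodable α] [Primcodable β]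

theorem primrecPred_forall_mem {f : α → List β} {P : α → β → Prop} (hf : Primrec f)
    (hP : PrimrecRel P) : PrimrecPred fun a => ∀ b ∈ f a, P a b :=
  hP.swap.forall_mem_list.comp hf Primrec.id

theorem primrecPred_exists_mem {f : α → List β} {P : α → β → Prop} (hf : Primrec f)
    (hP : PrimrecRel P) : PrimrecPred fun a => ∃ b ∈ f a, P a b :=
  hP.swap.exists_mem_list.comp hf Primrec.id

theorem primrecPred_forall_lt {f : α → ℕ} {P : α → ℕ → Prop} (hf : Primrec f)
    (hP : PrimrecRel P) : PrimrecPred fun a => ∀ b < f a, P a b :=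
  (primrecPred_forall_mem (Primrec.list_range.comp hf) hP).of_eq fun a => by simp

theorem primrec_pow : Primrec₂ ((· ^ ·) : ℕ → ℕ → ℕ) :=
  Primrec₂.unpaired'.1 Nat.Primrec.pow

theorem primrec_words : Primrec₂ words := by
  refine (Primrec.nat_rec (f := fun _ : ℕ => [[]])
    (g := fun (n : ℕ) (q : ℕ × List (List ℕ)) =>
      q.2.flatMap fun l => (List.range (n + 1)).map fun v => v :: l) (Primrec.const _) ?_).of_eq
      fun n k => ?_
  · refine Primrec.list_flatMap (Primrec.snd.comp Primrec.snd) ?_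
    refine Primrec.list_map (Primrec.list_range.comp (Primrec.succ.comp
      (Primrec.fst.comp Primrec.fst))) ?_
    exact Primrec.list_cons.comp Primrec.snd (Primrec.snd.comp Primrec.fst)
  · induction k with
    | zero => rfl
    | succ k ih => simp only [words, ← ih]

theorem primrec_numPos : Primrec numPos := Primrec.fst

theorem primrec_moves : Primrec moves := Primrec.fst.comp Primrec.snd

theorem primrec_obsTable : Primrec obsTable := Primrec.snd.comp Primrec.snd

theorem primrec_numPlayers : Primrec numPlayers := Primrec.list_length.comp primrec_obsTable

theorem primrec_numStates : Primrec numStates := by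
  have hn : Primrec fun c => numPos c + 1 := Primrec.succ.comp primrec_numPos
  exact Primrec.nat_mul.comp hn (primrec_pow.comp (Primrec.const 2)
    (Primrec.nat_mul.comp primrec_numPlayers (Primrec.nat_mul.comp primrec_numPlayers
      (Primrec.nat_mul.comp hn (Primrec.const 2)))))

theorem primrec_obsSeq : Primrec fun q : Game × ℕ × List ℕ => obsSeq q.1 q.2.1 q.2.2 := by
  refine Primrec.list_map (Primrec.list_drop.comp (Primrec.const 1)
    (Primrec.snd.comp Primrec.snd)) ?_
  refine (Primrec.list_getD 0).comp ((Primrec.list_getD []).comp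
    (primrec_obsTable.comp (Primrec.fst.comp Primrec.fst))
    (Primrec.fst.comp (Primrec.snd.comp Primrec.fst))) Primrec.snd

theorem primrecPred_indist {c : α → Game} {i : α → ℕ} {π ρ : α → List ℕ} (hc : Primrec c)
    (hi : Primrec i) (hπ : Primrec π) (hρ : Primrec ρ) :
    PrimrecPred fun a => Indist (c a) (i a) (π a) (ρ a) :=
  Primrec.eq.comp (primrec_obsSeq.comp (hc.pair (hi.pair hπ)))
    (primrec_obsSeq.comp (hc.pair (hi.pair hρ)))

theorem step_iff (c : Game) (u w : ℕ) : Step c u w ↔ ∃ e ∈ moves c, e.1 = u ∧ e.2.2 = w := by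
  constructor
  · rintro ⟨a, ha⟩
    exact ⟨_, ha, rfl, rfl⟩
  · rintro ⟨⟨u, a, w⟩, h, rfl, rfl⟩
    exact ⟨a, h⟩

theorem primrecPred_step {c : α → Game} {u w : α → ℕ} (hc : Primrec c) (hu : Primrec u)
    (hw : Primrec w) : PrimrecPred fun a => Step (c a) (u a) (w a) := by
  refine (primrecPred_exists_mem (P := fun a e => e.1 = u a ∧ e.2.2 = w a)
    (primrec_moves.comp hc) ?_).of_eq fun a => (step_iff _ _ _).symm
  exact (Primrec.eq.comp (Primrec.fst.comp Primrec.snd) (hu.comp Primrec.fst)).and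
    (Primrec.eq.comp (Primrec.snd.comp (Primrec.snd.comp Primrec.snd)) (hw.comp Primrec.fst))

theorem isHistory_iff (c : Game) (π : List ℕ) :
    IsHistory c π ↔ π.head? = some 0 ∧ (∀ v ∈ π, v ≤ numPos c) ∧
      ∀ k < π.length - 1, Step c (π.getD k 0) (π.getD (k + 1) 0) := by
  rw [isHistory_iff_isChain]
  refine and_congr_right fun _ => and_congr_right fun _ => ?_
  rw [List.isChain_iff_getElem]
  constructor
  · intro h k hk
    simpa [List.getD_eq_getElem?_getD, show k < π.length by omega,
      show k + 1 < π.length by omega] using h k (by omega)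
  · intro h k hk
    simpa [List.getD_eq_getElem?_getD, show k < π.length by omega, hk] using h k (by omega)

theorem primrecPred_isHistory {c : α → Game} {π : α → List ℕ} (hc : Primrec c)
    (hπ : Primrec π) : PrimrecPred fun a => IsHistory (c a) (π a) := by
  refine PrimrecPred.of_eq (PrimrecPred.and ?_ (PrimrecPred.and ?_ ?_))
    fun a => (isHistory_iff (c a) (π a)).symm
  · exact Primrec.eq.comp (Primrec.list_head?.comp hπ) (Primrec.const _)
  · exact primrecPred_forall_mem hπ
      (Primrec.nat_le.comp Primrec.snd (primrec_numPos.comp (hc.comp Primrec.fst)))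
  · refine primrecPred_forall_lt
      (Primrec.nat_sub.comp (Primrec.list_length.comp hπ) (Primrec.const 1)) ?_
    exact primrecPred_step (hc.comp Primrec.fst)
      ((Primrec.list_getD 0).comp (hπ.comp Primrec.fst) Primrec.snd)
      ((Primrec.list_getD 0).comp (hπ.comp Primrec.fst) (Primrec.succ.comp Primrec.snd))

theorem infoSet_subset_iff_forall_mem_words {c : Game} {π : List ℕ} (hπ : π ≠ []) (i j : ℕ) :
    InfoSet c i π ⊆ InfoSet c j π ↔ ∀ ρ ∈ words (numPos c) π.length,
      ¬ (IsHistory c ρ ∧ Indist c i π ρ) ∨ Indist c j π ρ := by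
  constructor
  · intro h ρ _
    exact (em (IsHistory c ρ ∧ Indist c i π ρ)).symm.imp_right fun h' => (h h').2
  · rintro h ρ ⟨hρ, hi⟩
    refine ⟨hρ, (h ρ ?_).resolve_left (not_not.2 ⟨hρ, hi⟩)⟩
    rw [← hi.length_eq hπ hρ.ne_nil]
    exact hρ.mem_words

/-- A brute-force form of `HistHI` for nonempty lists. -/
def BoundedHistHI (c : Game) (π : List ℕ) : Prop :=
  ∀ i < numPlayers c, ∀ j < numPlayers c,
    (∀ ρ ∈ words (numPos c) π.length,
      ¬ (IsHistory c ρ ∧ Indist c i π ρ) ∨ Indist c j π ρ) ∨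
    (∀ ρ ∈ words (numPos c) π.length,
      ¬ (IsHistory c ρ ∧ Indist c j π ρ) ∨ Indist c i π ρ)

theorem histHI_iff_boundedHistHI {c : Game} {π : List ℕ} (hπ : π ≠ []) :
    HistHI c π ↔ BoundedHistHI c π := by
  simp only [HistHI, BoundedHistHI, infoSet_subset_iff_forall_mem_words hπ]

theorem primrecPred_forall_mem_words {c : α → Game} {π : α → List ℕ} {i j : α → ℕ}
    (hc : Primrec c) (hπ : Primrec π) (hi : Primrec i) (hj : Primrec j) :
    PrimrecPred fun a => ∀ ρ ∈ words (numPos (c a)) (π a).length,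
      ¬ (IsHistory (c a) ρ ∧ Indist (c a) (i a) (π a) ρ) ∨ Indist (c a) (j a) (π a) ρ := by
  refine primrecPred_forall_mem
    (primrec_words.comp (primrec_numPos.comp hc) (Primrec.list_length.comp hπ)) ?_
  have hc' := hc.comp (Primrec.fst (α := α) (β := List ℕ))
  have hπ' := hπ.comp (Primrec.fst (α := α) (β := List ℕ))
  exact ((primrecPred_isHistory hc' Primrec.snd).and
    (primrecPred_indist hc' (hi.comp Primrec.fst) hπ' Primrec.snd)).not.or
    (primrecPred_indist hc' (hj.comp Primrec.fst) hπ' Primrec.snd)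

theorem primrecPred_boundedHistHI {c : α → Game} {π : α → List ℕ} (hc : Primrec c)
    (hπ : Primrec π) : PrimrecPred fun a => BoundedHistHI (c a) (π a) := by
  refine primrecPred_forall_lt (primrec_numPlayers.comp hc) ?_
  refine primrecPred_forall_lt (primrec_numPlayers.comp (hc.comp Primrec.fst)) ?_
  have hc' := hc.comp ((Primrec.fst (α := α) (β := ℕ)).comp (Primrec.fst (β := ℕ)))
  have hπ' := hπ.comp ((Primrec.fst (α := α) (β := ℕ)).comp (Primrec.fst (β := ℕ)))
  have hi := (Primrec.snd (α := α) (β := ℕ)).comp (Primrec.fst (β := ℕ))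
  have hj := Primrec.snd (α := α × ℕ) (β := ℕ)
  exact (primrecPred_forall_mem_words hc' hπ' hi hj).or (primrecPred_forall_mem_words hc' hπ' hj hi)

theorem primrecPred_not_recurringHI : PrimrecPred fun c => ¬ RecurringHI c := by
  have key : ∀ c, (∃ T ∈ List.range (numStates c + 1),
      ∃ π ∈ words (numPos c) (T + numStates c + 1), IsHistory c π ∧
        ∀ t ∈ List.range (numStates c + 1), ¬ BoundedHistHI c (π.take (T + t + 1))) ↔
      ¬ RecurringHI c := by
    intro c
    rw [not_recurringHI_iff]
    refine exists_congr fun T => and_congr_right fun _ => exists_congr fun π =>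
      and_congr_right fun _ => and_congr_right fun hπ => forall₂_congr fun t _ => ?_
    rw [histHI_iff_boundedHistHI (hπ.take (T + t)).ne_nil]
  refine PrimrecPred.of_eq ?_ key
  have hrange : Primrec fun c => List.range (numStates c + 1) :=
    Primrec.list_range.comp (Primrec.succ.comp primrec_numStates)
  refine primrecPred_exists_mem hrange ?_
  refine primrecPred_exists_mem (α := Game × ℕ)
    (primrec_words.comp (primrec_numPos.comp Primrec.fst) (Primrec.succ.comp
      (Primrec.nat_add.comp Primrec.snd (primrec_numStates.comp Primrec.fst)))) ?_
  have hc := (Primrec.fst (α := Game) (β := ℕ)).comp (Primrec.fst (β := List ℕ))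
  refine PrimrecPred.and (primrecPred_isHistory hc Primrec.snd) ?_
  refine primrecPred_forall_mem (α := (Game × ℕ) × List ℕ) (hrange.comp hc) ?_
  refine (primrecPred_boundedHistHI (hc.comp Primrec.fst) (Primrec.list_take.comp
    (Primrec.succ.comp (Primrec.nat_add.comp ?_ Primrec.snd))
    (Primrec.snd.comp Primrec.fst))).not
  exact Primrec.snd.comp (Primrec.fst.comp Primrec.fst)

end Primrec

end CG

/-- It is decidable, given a finite game graph, whether it yields recurring
hierarchical information, i.e., whether every play has infinitely many prefix histories that
yield hierarchical information. -/
theorem statement15 : ComputablePred (fun c : CG.Game => CG.RecurringHI c) :=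
  CG.primrecPred_not_recurringHI.not.computablePred.of_eq fun _ => not_not
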